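/- arXiv:0804.0642 — 5 statements merged into one kernel-verified Lean document; each statement's English description precedes it below -/
import Mathlib

section
/- Let G be a group, A and B subgroups of G, φ : A → B an isomorphism, and let 𝒢 = ⟨G, t ; t⁻¹at = φ(a), a ∈ A⟩ be the HNN extension of G relative to A, B, φ. Let {gᵢ ; i ∈ I} be a complete set of representatives of the left cosets of A in G and {hⱼ ; j ∈ J} a complete set of representatives of the left cosets of B in G, with 1 representing both A and B. Then every element w of 𝒢 can be written as w = g₁ t^{ε₁} g₂ t^{ε₂} ⋯ gₙ t^{εₙ} g_{n+1} (n ≥ 0, each ε_l = ±1, each g_l ∈ G), where for 1 ≤ l ≤ n: (1) if ε_l = 1 then g_l ∈ {gᵢ ; i ∈ I}; (2) if ε_l = −1 then g_l ∈ {hⱼ ; j ∈ J}; (3) there is no index l with 1 ≤ l < n such that g_{l+1} = 1 and ε_{l+1} = −ε_l (i.e., no subwords tt⁻¹ or t⁻¹t occur); and (4) g_{n+1} is an arbitrary element of G. -/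
/- The paper's HNN extension `𝒢 = ⟨G, t ; t⁻¹ a t = φ(a), a ∈ A⟩` is, in Mathlib's
convention (where `HNNExtension G A B φ` satisfies `t a t⁻¹ = φ a`), the group
`HNNExtension G B A φ.symm`. -/

/-- `L` and `g` give a normal form of `w`. -/
def HnnNF {G K : Type*} [Group G] [Group K] (T : ℤ → Set G) (o : G →* K) (t : K) (w : K) : Prop :=
  ∃ (L : List (G × ℤ)) (g : G), (∀ p ∈ L, (p.2 = 1 ∨ p.2 = -1) ∧ p.1 ∈ T p.2) ∧
    L.IsChain (fun p q => ¬ (q.1 = 1 ∧ q.2 = -p.2)) ∧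
    w = (L.map (fun p => o p.1 * t ^ p.2)).prod * o g

theorem HnnNF.mul_t {G K : Type*} [Group G] [Group K] {T : ℤ → Set G} {o : G →* K} {t : K}
    {w : K} (hw : HnnNF T o t w) (e : ℤ) (he : e = 1 ∨ e = -1)
    (hT : ∀ g : G, ∃ r ∈ T e, ∃ s, o g * t ^ e = o r * t ^ e * o s) :
    HnnNF T o t (w * t ^ e) := by
  obtain ⟨L, g, h1, h2, rfl⟩ := hw
  obtain ⟨r, hr, s, hs⟩ := hT g
  by_cases hc : (L ++ [(r, e)]).IsChain (fun p q => ¬ (q.1 = 1 ∧ q.2 = -p.2))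
  · refine ⟨L ++ [(r, e)], s, ?_, hc, ?_⟩
    · intro p hp
      rcases List.mem_append.1 hp with hp | hp
      · exact h1 p hp
      · obtain rfl := List.mem_singleton.1 hp
        exact ⟨he, hr⟩
    · simp [mul_assoc, hs]
  · rcases List.eq_nil_or_concat L with rfl | ⟨L', q, rfl⟩
    · simp at hc
    · have hq : r = 1 ∧ e = -q.2 := by
        by_contra hq
        apply hc
        rw [List.isChain_append]
        refine ⟨h2, by simp, ?_⟩
        simpa using hq
      obtain ⟨rfl, rfl⟩ := hq
      refine ⟨L', q.1 * s, fun p hp => h1 p (by simp [hp]), ?_, ?_⟩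
      · exact (List.isChain_append.1 (List.concat_eq_append ▸ h2)).1
      · rw [mul_assoc, hs]
        simp [mul_assoc]

theorem stmt_2 {G : Type*} [Group G] (A B : Subgroup G) (φ : A ≃* B)
    (TA TB : Set G)
    -- `TA` is a complete set of representatives of the left cosets of `A` in `G`
    (hTA : ∀ g : G, ∃! r, r ∈ TA ∧ r⁻¹ * g ∈ A)
    -- `TB` is a complete set of representatives of the left cosets of `B` in `G`
    (hTB : ∀ g : G, ∃! r, r ∈ TB ∧ r⁻¹ * g ∈ B)
    -- `1` represents both `A` and `B`
    (hTA1 : (1 : G) ∈ TA) (hTB1 : (1 : G) ∈ TB)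
    (w : HNNExtension G B A φ.symm) :
    -- `w = g₁ t^{ε₁} g₂ t^{ε₂} ⋯ gₙ t^{εₙ} g_{n+1}` where `L = [(g₁,ε₁),…,(gₙ,εₙ)]`
    ∃ (L : List (G × ℤ)) (gLast : G),
      (∀ p ∈ L, p.2 = 1 ∨ p.2 = -1) ∧
      (∀ p ∈ L, p.2 = 1 → p.1 ∈ TA) ∧
      (∀ p ∈ L, p.2 = -1 → p.1 ∈ TB) ∧
      (∀ (l : ℕ) (h : l + 1 < L.length),
        ¬((L.get ⟨l + 1, h⟩).1 = 1 ∧ (L.get ⟨l + 1, h⟩).2 = -(L.get ⟨l, by omega⟩).2)) ∧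
      w = (L.map (fun p => HNNExtension.of p.1 * HNNExtension.t ^ p.2)).prod
            * HNNExtension.of gLast := by
  let T : ℤ → Set G := fun e => if e = 1 then TA else TB
  have key : HnnNF T (HNNExtension.of : G →* HNNExtension G B A φ.symm) HNNExtension.t w := by
    have hm : ∀ x y : HNNExtension G B A φ.symm, HnnNF T HNNExtension.of HNNExtension.t y →
        HnnNF T HNNExtension.of HNNExtension.t (y * x) ∧
        HnnNF T HNNExtension.of HNNExtension.t (y * x⁻¹) := by
      intro x
      induction x using HNNExtension.induction_on with
      | of g =>
        have ho : ∀ (g : G) (y : HNNExtension G B A φ.symm),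
            HnnNF T HNNExtension.of HNNExtension.t y →
            HnnNF T HNNExtension.of HNNExtension.t (y * HNNExtension.of g) := by
          rintro g y ⟨L, k, h1, h2, rfl⟩
          exact ⟨L, k * g, h1, h2, by simp [mul_assoc]⟩
        intro y hy
        exact ⟨ho g y hy, by simpa using ho g⁻¹ y hy⟩
      | t =>
        intro y hy
        constructor
        · have := hy.mul_t 1 (Or.inl rfl) (fun g => by
            obtain ⟨r, ⟨hr, ha⟩, -⟩ := hTA g
            refine ⟨r, by simpa [T] using hr, φ ⟨_, ha⟩, ?_⟩
            have := HNNExtension.of_mul_t (φ := φ.symm) ⟨_, ha⟩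
            simp only [MulEquiv.symm_symm] at this
            rw [zpow_one, mul_assoc, ← this]
            simp [mul_assoc])
          simpa using this
        · have := hy.mul_t (-1) (Or.inr rfl) (fun g => by
            obtain ⟨r, ⟨hr, ha⟩, -⟩ := hTB g
            refine ⟨r, by simpa [T] using hr, φ.symm ⟨_, ha⟩, ?_⟩
            have := HNNExtension.of_mul_inv_t (φ := φ.symm) ⟨_, ha⟩
            rw [zpow_neg_one, mul_assoc, ← this]
            simp [mul_assoc])
          simpa using this
      | mul a b iha ihb =>
        intro y hy
        constructor
        · rw [← mul_assoc]
          exact (ihb _ (iha _ hy).1).1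
        · rw [mul_inv_rev, ← mul_assoc]
          exact (iha _ (ihb _ hy).2).2
      | inv a ih =>
        intro y hy
        rw [inv_inv]
        exact (ih y hy).symm
    have h := (hm w 1 ⟨[], 1, by simp, by simp, by simp⟩).1
    rwa [one_mul] at h
  obtain ⟨L, g, h1, h2, h3⟩ := key
  refine ⟨L, g, fun p hp => (h1 p hp).1, ?_, ?_, ?_, h3⟩
  · intro p hp he
    simpa [T, he] using (h1 p hp).2
  · intro p hp he
    simpa [T, he] using (h1 p hp).2
  · intro l h
    exact List.isChain_iff_getElem.1 h2 l (by omega)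
end

section
/- Let G be a group, A and B subgroups of G, φ : A → B an isomorphism, and let 𝒢 = ⟨G, t ; t⁻¹at = φ(a), a ∈ A⟩ be the HNN extension of G relative to A, B, φ. Let {gᵢ ; i ∈ I} be a complete set of representatives of the left cosets of A in G and {hⱼ ; j ∈ J} a complete set of representatives of the left cosets of B in G, with 1 representing both A and B. Call a tuple (n; ε₁,…,εₙ; g₁,…,g_{n+1}) with n ≥ 0, ε_l = ±1, g_l ∈ G a normal form if: (1) ε_l = 1 implies g_l ∈ {gᵢ ; i ∈ I}; (2) ε_l = −1 implies g_l ∈ {hⱼ ; j ∈ J}; (3) there is no index l with 1 ≤ l < n such that g_{l+1} = 1 and ε_{l+1} = −ε_l. Then two normal forms yielding equal elements g₁ t^{ε₁} ⋯ gₙ t^{εₙ} g_{n+1} = g'₁ t^{δ₁} ⋯ g'ₘ t^{δₘ} g'_{m+1} in 𝒢 coincide: n = m, ε_l = δ_l for all l, and g_l = g'_l for all l. In particular, every element of 𝒢 has a unique normal form representation. -/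
/- The paper's HNN extension `𝒢 = ⟨G, t ; t⁻¹ a t = φ(a), a ∈ A⟩` is, in Mathlib's
convention (where `HNNExtension G A B φ` satisfies `t a t⁻¹ = φ a`), the group
`HNNExtension G B A φ.symm`. -/

/-- The list `L = [(g₁,ε₁),…,(gₙ,εₙ)]` of syllables of a word
`g₁ t^{ε₁} g₂ t^{ε₂} ⋯ gₙ t^{εₙ} g_{n+1}` is in normal form with respect to the left coset
representative sets `TA` (for `A`) and `TB` (for `B`): each `ε` is `±1`, `ε_l = 1` forces
`g_l ∈ TA`, `ε_l = -1` forces `g_l ∈ TB`, and there is no `l` with `g_{l+1} = 1` and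
`ε_{l+1} = -ε_l` (no subword `t t⁻¹` or `t⁻¹ t`). -/
def IsHNNNormalForm {G : Type*} [Group G] (TA TB : Set G) (L : List (G × ℤ)) : Prop :=
  (∀ p ∈ L, p.2 = 1 ∨ p.2 = -1) ∧
  (∀ p ∈ L, p.2 = 1 → p.1 ∈ TA) ∧
  (∀ p ∈ L, p.2 = -1 → p.1 ∈ TB) ∧
  (∀ (l : ℕ) (h : l + 1 < L.length),
    ¬((L.get ⟨l + 1, h⟩).1 = 1 ∧ (L.get ⟨l + 1, h⟩).2 = -(L.get ⟨l, by omega⟩).2))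

/-- A syllable is admissible. -/
def HNNOk {G : Type*} (TA TB : Set G) (p : G × ℤ) : Prop :=
  (p.2 = 1 ∧ p.1 ∈ TA) ∨ (p.2 = -1 ∧ p.1 ∈ TB)

/-- Two consecutive syllables do not cancel. -/
def HNNRel {G : Type*} [Group G] (a b : G × ℤ) : Prop := ¬(b.1 = 1 ∧ b.2 = -a.2)

theorem isHNN_iff {G : Type*} [Group G] (TA TB : Set G) (L : List (G × ℤ)) :
    IsHNNNormalForm TA TB L ↔ (∀ p ∈ L, HNNOk TA TB p) ∧ L.IsChain HNNRel := by
  have hc : L.IsChain HNNRel ↔ ∀ (l : ℕ) (h : l + 1 < L.length),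
      ¬((L.get ⟨l + 1, h⟩).1 = 1 ∧ (L.get ⟨l + 1, h⟩).2 = -(L.get ⟨l, by omega⟩).2) := by
    rw [List.isChain_iff_getElem]
    exact Iff.rfl
  rw [hc]
  unfold IsHNNNormalForm
  constructor
  · rintro ⟨h1, h2, h3, h4⟩
    refine ⟨fun p hp => ?_, h4⟩
    rcases h1 p hp with h | h
    · exact Or.inl ⟨h, h2 p hp h⟩
    · exact Or.inr ⟨h, h3 p hp h⟩
  · rintro ⟨h1, h4⟩
    refine ⟨fun p hp => ?_, fun p hp h => ?_, fun p hp h => ?_, h4⟩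
    · rcases h1 p hp with h | h
      · exact Or.inl h.1
      · exact Or.inr h.1
    · rcases h1 p hp with h' | h'
      · exact h'.2
      · have := h'.1; omega
    · rcases h1 p hp with h' | h'
      · have := h'.1; omega
      · exact h'.2

/-- The element represented by a word. -/
def hnnVal {G : Type*} [Group G] {A B : Subgroup G} (φ : A ≃* B)
    (L : List (G × ℤ)) (g : G) : HNNExtension G B A φ.symm :=
  (L.map (fun p => (HNNExtension.of p.1 : HNNExtension G B A φ.symm)
              * HNNExtension.t ^ p.2)).prod * HNNExtension.of g

def hnnHd {G : Type*} : List (G × ℤ) → G → G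
  | [], g => g
  | p :: _, _ => p.1

def hnnU (e : ℤ) : ℤˣ := if e = 1 then 1 else -1

def hnnTl {G : Type*} : List (G × ℤ) → G → List (ℤˣ × G)
  | [], _ => []
  | p :: L, g => (hnnU p.2, hnnHd L g) :: hnnTl L g

theorem hnnVal_eq {G : Type*} [Group G] {A B : Subgroup G} (φ : A ≃* B) (TA TB : Set G)
    (L : List (G × ℤ)) (g : G) (h : ∀ p ∈ L, HNNOk TA TB p) :
    hnnVal φ L g = HNNExtension.of (hnnHd L g) *
      ((hnnTl L g).map (fun x => HNNExtension.t ^ (x.1 : ℤ) * HNNExtension.of x.2)).prod := by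
  induction L with
  | nil => simp [hnnVal, hnnHd, hnnTl]
  | cons p L ih =>
    have ih := ih (fun q hq => h q (List.mem_cons_of_mem _ hq))
    have hp : ((hnnU p.2 : ℤˣ) : ℤ) = p.2 := by
      rcases h p List.mem_cons_self with h | h <;> simp [hnnU, h.1]
    have : hnnVal φ (p :: L) g = HNNExtension.of p.1 * HNNExtension.t ^ p.2 * hnnVal φ L g := by
      simp [hnnVal, mul_assoc]
    rw [this, ih]
    simp [hnnHd, hnnTl, hp, mul_assoc]

theorem hnn_rep_eq {G : Type*} [Group G] {A : Subgroup G} {TA : Set G}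
    (hTA : ∀ g : G, ∃! r, r ∈ TA ∧ r⁻¹ * g ∈ A) {x y : G} (hx : x ∈ TA) (hy : y ∈ TA)
    (h : x⁻¹ * y ∈ A) : x = y :=
  (hTA y).unique ⟨hx, h⟩ ⟨hy, by simp⟩

theorem hnnTl_chain {G : Type*} [Group G] (A B : Subgroup G) (TA TB : Set G)
    (hTA : ∀ g : G, ∃! r, r ∈ TA ∧ r⁻¹ * g ∈ A)
    (hTB : ∀ g : G, ∃! r, r ∈ TB ∧ r⁻¹ * g ∈ B)
    (hTA1 : (1 : G) ∈ TA) (hTB1 : (1 : G) ∈ TB)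
    (L : List (G × ℤ)) (g : G) (h : ∀ p ∈ L, HNNOk TA TB p) (hc : L.IsChain HNNRel) :
    (hnnTl L g).IsChain (fun a b => a.2 ∈ HNNExtension.toSubgroup B A a.1 → a.1 = b.1) := by
  induction L with
  | nil => simp [hnnTl]
  | cons p L ih =>
    have ih := ih (fun q hq => h q (List.mem_cons_of_mem _ hq)) (List.isChain_cons.1 hc).2
    cases L with
    | nil => simp [hnnTl]
    | cons q L =>
      rw [hnnTl]
      rw [hnnTl] at ih ⊢
      rw [List.isChain_cons_cons]
      refine ⟨?_, ih⟩
      have hr : HNNRel p q := (List.isChain_cons_cons.1 hc).1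
      simp only [hnnHd]
      rcases h p (by simp) with hp | hp <;> rcases h q (by simp) with hq | hq <;>
        simp only [hnnU, hp.1, hq.1, if_true]
      · simp
      · intro hm
        have hm : q.1 ∈ B := hm
        exact absurd ⟨(hnn_rep_eq hTB hTB1 hq.2 (by simpa using hm)).symm, by rw [hp.1, hq.1]⟩ hr
      · intro hm
        have hm : q.1 ∈ A := hm
        exact absurd ⟨(hnn_rep_eq hTA hTA1 hq.2 (by simpa using hm)).symm,
          by rw [hp.1, hq.1]; rfl⟩ hr
      · simp

theorem hnn_unique {G : Type*} [Group G] (A B : Subgroup G) (φ : A ≃* B) (TA TB : Set G)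
    (hTA : ∀ g : G, ∃! r, r ∈ TA ∧ r⁻¹ * g ∈ A)
    (hTB : ∀ g : G, ∃! r, r ∈ TB ∧ r⁻¹ * g ∈ B)
    (hTA1 : (1 : G) ∈ TA) (hTB1 : (1 : G) ∈ TB)
    (L : List (G × ℤ)) (g : G) (h : ∀ p ∈ L, HNNOk TA TB p) (hc : L.IsChain HNNRel)
    (L' : List (G × ℤ)) (g' : G) (h' : ∀ p ∈ L', HNNOk TA TB p) (hc' : L'.IsChain HNNRel)
    (heq : hnnVal φ L g = hnnVal φ L' g') : L = L' ∧ g = g' := by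
  induction L generalizing L' with
  | nil =>
    have key := HNNExtension.ReducedWord.map_fst_eq_and_of_prod_eq φ.symm
      (w₁ := ⟨hnnHd [] g, hnnTl [] g, hnnTl_chain A B TA TB hTA hTB hTA1 hTB1 _ _ h hc⟩)
      (w₂ := ⟨hnnHd L' g', hnnTl L' g', hnnTl_chain A B TA TB hTA hTB hTA1 hTB1 _ _ h' hc'⟩)
      (by
        unfold HNNExtension.NormalWord.ReducedWord.prod
        rw [← hnnVal_eq φ TA TB _ _ h, ← hnnVal_eq φ TA TB _ _ h', heq])
    cases L' with
    | nil =>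
      refine ⟨rfl, ?_⟩
      simp only [hnnVal, List.map_nil, List.prod_nil, one_mul] at heq
      exact HNNExtension.of_injective φ.symm heq
    | cons q L' => simp [hnnTl] at key
  | cons p L ih =>
    have key := HNNExtension.ReducedWord.map_fst_eq_and_of_prod_eq φ.symm
      (w₁ := ⟨hnnHd (p :: L) g, hnnTl (p :: L) g,
        hnnTl_chain A B TA TB hTA hTB hTA1 hTB1 _ _ h hc⟩)
      (w₂ := ⟨hnnHd L' g', hnnTl L' g', hnnTl_chain A B TA TB hTA hTB hTA1 hTB1 _ _ h' hc'⟩)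
      (by
        unfold HNNExtension.NormalWord.ReducedWord.prod
        rw [← hnnVal_eq φ TA TB _ _ h, ← hnnVal_eq φ TA TB _ _ h', heq])
    cases L' with
    | nil => simp [hnnTl] at key
    | cons q L' =>
      have hpq : p = q := by
        obtain ⟨k1, k2⟩ := key
        simp only [hnnTl, List.map_cons, List.cons.injEq] at k1
        have k1 := k1.1
        have k2 := k2 (hnnU p.2) (by simp [hnnTl])
        simp only [hnnHd] at k2
        rcases h p (by simp) with hp | hp <;> rcases h' q (by simp) with hq | hq <;>
          simp only [hnnU, hp.1, hq.1, if_true] at k1 k2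
        · exact Prod.ext (hnn_rep_eq hTA hp.2 hq.2 k2) (by rw [hp.1, hq.1])
        · exact absurd k1 (by decide)
        · exact absurd k1 (by decide)
        · exact Prod.ext (hnn_rep_eq hTB hp.2 hq.2 k2) (by rw [hp.1, hq.1])
      subst hpq
      have hcons : ∀ (M : List (G × ℤ)) (x : G), hnnVal φ (p :: M) x
          = HNNExtension.of p.1 * HNNExtension.t ^ p.2 * hnnVal φ M x := by
        intro M x; simp [hnnVal, mul_assoc]
      rw [hcons, hcons] at heq
      have := ih (fun q hq => h q (List.mem_cons_of_mem _ hq)) (List.isChain_cons.1 hc).2 L'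
        (fun q hq => h' q (List.mem_cons_of_mem _ hq)) (List.isChain_cons.1 hc').2
        (mul_left_cancel heq)
      exact ⟨by rw [this.1], this.2⟩

/-- Elements having a normal form. -/
def HNNRep {G : Type*} [Group G] {A B : Subgroup G} (φ : A ≃* B) (TA TB : Set G)
    (w : HNNExtension G B A φ.symm) : Prop :=
  ∃ (L : List (G × ℤ)) (g : G), (∀ p ∈ L, HNNOk TA TB p) ∧ L.IsChain HNNRel ∧ w = hnnVal φ L g

/-- Right multiplication of a normal form by a stable letter. -/
theorem hnn_step {G : Type*} [Group G] {A B : Subgroup G} (φ : A ≃* B) (TA TB : Set G)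
    (L : List (G × ℤ)) (r c : G) (e : ℤ)
    (h : ∀ p ∈ L, HNNOk TA TB p) (hc : L.IsChain HNNRel) (hr : HNNOk TA TB (r, e)) :
    HNNRep φ TA TB (hnnVal φ L r * HNNExtension.t ^ e * HNNExtension.of c) := by
  by_cases hl : ∀ q ∈ L.getLast?, HNNRel q (r, e)
  · refine ⟨L ++ [(r, e)], c, ?_, ?_, ?_⟩
    · intro p hp
      rcases List.mem_append.1 hp with hp | hp
      · exact h p hp
      · rw [List.mem_singleton.1 hp]; exact hr
    · rw [List.isChain_append]
      exact ⟨hc, by simp, by simpa using hl⟩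
    · simp [hnnVal, mul_assoc]
  · push Not at hl
    obtain ⟨q, hq, hn⟩ := hl
    obtain ⟨M, rfl⟩ := List.getLast?_eq_some_iff.1 hq
    have hn := not_not.1 hn
    obtain ⟨h1, h2⟩ := hn
    simp only at h1 h2
    refine ⟨M, q.1 * c, fun p hp => h p (by simp [hp]), (List.isChain_append.1 hc).1, ?_⟩
    simp [hnnVal, mul_assoc, h1, h2]

theorem hnn_mul_t {G : Type*} [Group G] {A B : Subgroup G} (φ : A ≃* B) (TA TB : Set G)
    (hTA : ∀ g : G, ∃! r, r ∈ TA ∧ r⁻¹ * g ∈ A) (w : HNNExtension G B A φ.symm)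
    (hw : HNNRep φ TA TB w) : HNNRep φ TA TB (w * HNNExtension.t) := by
  obtain ⟨L, g, h, hc, rfl⟩ := hw
  obtain ⟨r, ⟨hr, ha⟩, -⟩ := hTA g
  have := hnn_step φ TA TB L r (φ ⟨_, ha⟩ : G) 1 h hc (Or.inl ⟨rfl, hr⟩)
  convert this using 1
  have e := HNNExtension.of_mul_t (φ := φ.symm) ⟨_, ha⟩
  simp only [MulEquiv.symm_symm] at e
  rw [zpow_one, mul_assoc, ← e]
  simp [hnnVal, mul_assoc]

theorem hnn_mul_t_inv {G : Type*} [Group G] {A B : Subgroup G} (φ : A ≃* B) (TA TB : Set G)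
    (hTB : ∀ g : G, ∃! r, r ∈ TB ∧ r⁻¹ * g ∈ B) (w : HNNExtension G B A φ.symm)
    (hw : HNNRep φ TA TB w) : HNNRep φ TA TB (w * HNNExtension.t⁻¹) := by
  obtain ⟨L, g, h, hc, rfl⟩ := hw
  obtain ⟨r, ⟨hr, ha⟩, -⟩ := hTB g
  have := hnn_step φ TA TB L r (φ.symm ⟨_, ha⟩ : G) (-1) h hc (Or.inr ⟨rfl, hr⟩)
  convert this using 1
  have e := HNNExtension.of_mul_inv_t (φ := φ.symm) ⟨_, ha⟩
  rw [zpow_neg_one, mul_assoc, ← e]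
  simp [hnnVal, mul_assoc]

theorem hnn_mul_of {G : Type*} [Group G] {A B : Subgroup G} (φ : A ≃* B) (TA TB : Set G)
    (w : HNNExtension G B A φ.symm) (x : G)
    (hw : HNNRep φ TA TB w) : HNNRep φ TA TB (w * HNNExtension.of x) := by
  obtain ⟨L, g, h, hc, rfl⟩ := hw
  exact ⟨L, g * x, h, hc, by simp [hnnVal, mul_assoc]⟩

theorem hnn_exists {G : Type*} [Group G] {A B : Subgroup G} (φ : A ≃* B) (TA TB : Set G)
    (hTA : ∀ g : G, ∃! r, r ∈ TA ∧ r⁻¹ * g ∈ A)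
    (hTB : ∀ g : G, ∃! r, r ∈ TB ∧ r⁻¹ * g ∈ B)
    (w : HNNExtension G B A φ.symm) : HNNRep φ TA TB w := by
  have key : ∀ v, HNNRep φ TA TB v → HNNRep φ TA TB (v * w) ∧ HNNRep φ TA TB (v * w⁻¹) := by
    induction w using HNNExtension.induction_on with
    | of g =>
      intro v hv
      refine ⟨hnn_mul_of φ TA TB v g hv, ?_⟩
      rw [← map_inv]
      exact hnn_mul_of φ TA TB v g⁻¹ hv
    | t => exact fun v hv => ⟨hnn_mul_t φ TA TB hTA v hv, hnn_mul_t_inv φ TA TB hTB v hv⟩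
    | mul x y hx hy =>
      intro v hv
      rw [mul_inv_rev, ← mul_assoc, ← mul_assoc]
      exact ⟨(hy _ (hx v hv).1).1, (hx _ (hy v hv).2).2⟩
    | inv x hx =>
      intro v hv
      rw [inv_inv]
      exact (hx v hv).symm
  have h1 : HNNRep φ TA TB 1 := ⟨[], 1, by simp, by simp, by simp [hnnVal]⟩
  simpa using (key 1 h1).1

theorem stmt_3 {G : Type*} [Group G] (A B : Subgroup G) (φ : A ≃* B)
    (TA TB : Set G)
    -- `TA` is a complete set of representatives of the left cosets of `A` in `G`
    (hTA : ∀ g : G, ∃! r, r ∈ TA ∧ r⁻¹ * g ∈ A)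
    -- `TB` is a complete set of representatives of the left cosets of `B` in `G`
    (hTB : ∀ g : G, ∃! r, r ∈ TB ∧ r⁻¹ * g ∈ B)
    -- `1` represents both `A` and `B`
    (hTA1 : (1 : G) ∈ TA) (hTB1 : (1 : G) ∈ TB)
    (L L' : List (G × ℤ)) (gLast gLast' : G)
    (hL : IsHNNNormalForm TA TB L) (hL' : IsHNNNormalForm TA TB L')
    (heq : (L.map (fun p => (HNNExtension.of p.1 : HNNExtension G B A φ.symm)
              * HNNExtension.t ^ p.2)).prod * HNNExtension.of gLast
         = (L'.map (fun p => (HNNExtension.of p.1 : HNNExtension G B A φ.symm)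
              * HNNExtension.t ^ p.2)).prod * HNNExtension.of gLast') :
    (L = L' ∧ gLast = gLast') ∧
      -- in particular, every element of `𝒢` has a unique normal form representation
      ∀ w : HNNExtension G B A φ.symm,
        ∃! q : List (G × ℤ) × G,
          IsHNNNormalForm TA TB q.1 ∧
          w = (q.1.map (fun p => HNNExtension.of p.1 * HNNExtension.t ^ p.2)).prod
                * HNNExtension.of q.2 := by
  rw [isHNN_iff] at hL hL'
  refine ⟨hnn_unique A B φ TA TB hTA hTB hTA1 hTB1 L gLast hL.1 hL.2 L' gLast' hL'.1 hL'.2 heq,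
    fun w => ?_⟩
  obtain ⟨M, g, h, hc, hw⟩ := hnn_exists φ TA TB hTA hTB w
  refine ⟨(M, g), ⟨(isHNN_iff _ _ _).2 ⟨h, hc⟩, hw⟩, ?_⟩
  rintro ⟨M', g'⟩ ⟨h', hw'⟩
  have h' := (isHNN_iff _ _ _).1 h'
  have := hnn_unique A B φ TA TB hTA hTB hTA1 hTB1 M g h hc M' g' h'.1 h'.2 (hw.symm.trans hw')
  exact Prod.ext this.1.symm this.2.symm
end

section
/- Let n ≥ 5 and in the symmetric group Sₙ on {1, 2, …, n} define xᵢ = (1 2)((i+1)(i+2)) for 1 ≤ i ≤ n−2, where (a b) denotes the transposition of a and b, and for j > i ≥ 2 define x_{ji} = xⱼx_{j−1}⋯xᵢ. Then x_{ji}xⱼ = x_{j−1}x_{ji} for all i, j with 2 ≤ i < j ≤ n−2. -/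
/-- `permX n i` is the permutation `(1 2)((i+1)(i+2))` of `{1, …, n}`, written as a
permutation of `Fin n` (so the points `1, 2` of `{1,…,n}` are `⟨0,_⟩, ⟨1,_⟩ : Fin n` and
the points `i+1, i+2` are `⟨i,_⟩, ⟨i+1,_⟩`). Junk value `1` if `i+1 ≥ n`. -/
def permX (n i : ℕ) : Equiv.Perm (Fin n) :=
  if h : i + 1 < n then
    Equiv.swap ⟨0, by omega⟩ ⟨1, by omega⟩ * Equiv.swap ⟨i, by omega⟩ ⟨i + 1, h⟩
  else 1


/-- `permXji n j i = xⱼ x_{j-1} ⋯ xᵢ` (indices descending). -/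
def permXji (n j i : ℕ) : Equiv.Perm (Fin n) :=
  (((List.range' i (j + 1 - i)).reverse).map (permX n)).prod

theorem permX_comm_aux (n k j : ℕ) (hk : 2 ≤ k) (hkj : k + 2 ≤ j) (hj : j + 1 < n) :
    Commute (permX n k) (permX n j) := by
  have h : k + 1 < n := by omega
  show _ = _
  ext x
  simp only [permX, h, hj, dif_pos, Equiv.Perm.mul_apply, Equiv.swap_apply_def, Fin.ext_iff]
  grind

theorem permX_braid_aux (n k : ℕ) (hk : 2 ≤ k) (hj : k + 1 + 1 < n) :
    permX n (k + 1) * permX n k * permX n (k + 1) = permX n k * permX n (k + 1) * permX n k := by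
  have h : k + 1 < n := by omega
  ext x
  simp only [permX, h, hj, dif_pos, Equiv.Perm.mul_apply, Equiv.swap_apply_def, Fin.ext_iff]
  grind

theorem stmt_8 (n : ℕ) (hn : 5 ≤ n) (i j : ℕ) (hi : 2 ≤ i) (hij : i < j)
    (hj : j ≤ n - 2) :
    permXji n j i * permX n j = permX n (j - 1) * permXji n j i := by
  obtain ⟨m, rfl⟩ : ∃ m, j = i + m + 1 := ⟨j - i - 1, by omega⟩
  have hX : permXji n (i + m + 1) i = permX n (i + m + 1) * (permX n (i + m) *
      ((List.range' i m).reverse.map (permX n)).prod) := by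
    unfold permXji
    rw [show i + m + 1 + 1 - i = m + 1 + 1 by omega, List.range'_1_concat, List.range'_1_concat]
    simp [add_assoc]
  have hW : Commute ((List.range' i m).reverse.map (permX n)).prod (permX n (i + m + 1)) := by
    apply Commute.list_prod_left
    intro y hy
    simp only [List.mem_map, List.mem_reverse, List.mem_range'_1] at hy
    obtain ⟨k, hk, rfl⟩ := hy
    exact permX_comm_aux n k _ (by omega) (by omega) (by omega)
  have hb := permX_braid_aux n (i + m) (by omega) (by omega)
  rw [hX, Nat.add_sub_cancel, mul_assoc, mul_assoc, hW.eq]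
  simp only [← mul_assoc]
  rw [hb]
end

section
/- Let n ≥ 5 and in the symmetric group Sₙ on {1, 2, …, n} define xᵢ = (1 2)((i+1)(i+2)) for 1 ≤ i ≤ n−2, where (a b) denotes the transposition of a and b, and for j ≥ 2 and ε = ±1 define x_{j1ε} = xⱼx_{j−1}⋯x₂x₁^{ε}. Then x_{j1ε}xⱼ = x_{j−1}x_{j1,−ε} for all j with 2 < j ≤ n−2 and ε = ±1. -/
/-- `permXj1 n j ε = xⱼ x_{j-1} ⋯ x₂ x₁^ε`. -/
def permXj1 (n j : ℕ) (ε : ℤ) : Equiv.Perm (Fin n) :=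
  permXji n j 2 * (permX n 1) ^ ε

lemma permX_comm (n i j : ℕ) (hi : 2 ≤ i) (hij : i + 1 < j) (hj : j + 1 < n) :
    permX n i * permX n j = permX n j * permX n i := by
  have h : i + 1 < n := by omega
  unfold permX
  rw [dif_pos h, dif_pos hj]
  ext x
  simp only [Equiv.Perm.mul_apply, Equiv.swap_apply_def]
  grind

lemma permX_braid (n i : ℕ) (hi : 2 ≤ i) (hj : i + 2 < n) :
    permX n (i + 1) * permX n i * permX n (i + 1) = permX n i * permX n (i + 1) * permX n i := by
  have h : i + 1 < n := by omega
  have h2 : i + 1 + 1 < n := by omega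
  unfold permX
  rw [dif_pos h, dif_pos h2]
  ext x
  simp only [Equiv.Perm.mul_apply, Equiv.swap_apply_def]
  grind

lemma permX_one (n j : ℕ) (hi : 3 ≤ j) (hj : j + 1 < n) :
    permX n 1 * permX n j * permX n 1 = permX n j := by
  have h : 1 + 1 < n := by omega
  unfold permX
  rw [dif_pos h, dif_pos hj]
  ext x
  simp only [Equiv.Perm.mul_apply, Equiv.swap_apply_def]
  grind

lemma permXji_succ (n j : ℕ) (hj : 1 ≤ j) :
    permXji n (j + 1) 2 = permX n (j + 1) * permXji n j 2 := by
  obtain ⟨k, rfl⟩ : ∃ k, j = k + 1 := ⟨j - 1, by omega⟩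
  have e1 : k + 1 + 1 + 1 - 2 = k + 1 := by omega
  have e2 : k + 1 + 1 - 2 = k := by omega
  unfold permXji
  rw [e1, e2, List.range'_concat]
  simp [show 2 + k = k + 1 + 1 by omega]

lemma permXji_comm (n j k : ℕ) (hk : 1 ≤ k) (hkj : k + 1 < j) (hj : j + 1 < n) :
    permXji n k 2 * permX n j = permX n j * permXji n k 2 := by
  induction k, hk using Nat.le_induction with
  | base => simp [permXji]
  | succ k hk ih =>
    rw [permXji_succ n k hk, mul_assoc, ih (by omega), ← mul_assoc,
      permX_comm n (k + 1) j (by omega) hkj hj, mul_assoc]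

theorem stmt_9 (n : ℕ) (hn : 5 ≤ n) (j : ℕ) (hj1 : 2 < j) (hj2 : j ≤ n - 2)
    (ε : ℤ) (hε : ε = 1 ∨ ε = -1) :
    permXj1 n j ε * permX n j = permX n (j - 1) * permXj1 n j (-ε) := by
  have h1 : permX n 1 ^ ε * permX n j = permX n j * permX n 1 ^ (-ε) := by
    have h := permX_one n j hj1 (by omega)
    rcases hε with rfl | rfl
    · rw [zpow_neg, zpow_one, eq_mul_inv_iff_mul_eq, h]
    · rw [neg_neg, zpow_neg, zpow_one, inv_mul_eq_iff_eq_mul, ← mul_assoc, h]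
  obtain ⟨k, rfl⟩ : ∃ k, j = k + 1 + 1 := ⟨j - 2, by omega⟩
  have h2 : permXji n (k + 1 + 1) 2 * permX n (k + 1 + 1)
      = permX n (k + 1) * permXji n (k + 1 + 1) 2 := by
    rw [permXji_succ n (k + 1) (by omega), permXji_succ n k (by omega), mul_assoc, mul_assoc,
      permXji_comm n (k + 1 + 1) k (by omega) (by omega) (by omega), ← mul_assoc, ← mul_assoc,
      permX_braid n (k + 1) (by omega) (by omega)]
    simp only [mul_assoc]
  unfold permXj1
  rw [mul_assoc, h1, ← mul_assoc, h2, mul_assoc]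
  rfl
end

section
/- Let G be a group, A and B subgroups of G, φ : A → B an isomorphism, and let 𝒢 = ⟨G, t ; t⁻¹at = φ(a), a ∈ A⟩ be the HNN extension of G relative to A, B, φ. If n ≥ 1 and g₀, g₁, …, gₙ ∈ G, ε₁, …, εₙ ∈ {1, −1} are such that the word g₀ t^{ε₁} g₁ t^{ε₂} ⋯ t^{εₙ} gₙ contains no pinch (i.e., there is no index l with 1 ≤ l < n such that either ε_l = −1, ε_{l+1} = 1 and g_l ∈ A, or ε_l = 1, ε_{l+1} = −1 and g_l ∈ B), then the element g₀ t^{ε₁} g₁ ⋯ t^{εₙ} gₙ of 𝒢 is not equal to the identity. In particular, the natural homomorphism G → 𝒢 is injective. -/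
/- The paper's HNN extension `𝒢 = ⟨G, t ; t⁻¹ a t = φ(a), a ∈ A⟩` is, in Mathlib's
convention (where `HNNExtension G A B φ` satisfies `t a t⁻¹ = φ a`), the group
`HNNExtension G B A φ.symm`. -/

theorem stmt_13 {G : Type*} [Group G] (A B : Subgroup G) (φ : A ≃* B)
    (n : ℕ) (hn : 1 ≤ n) (g : Fin (n + 1) → G) (ε : Fin n → ℤ)
    (hε : ∀ l, ε l = 1 ∨ ε l = -1)
    -- the word `g₀ t^{ε₁} g₁ ⋯ t^{εₙ} gₙ` contains no pinch
    (hpinch : ∀ (l : ℕ) (h : l + 1 < n),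
      ¬((ε ⟨l, by omega⟩ = -1 ∧ ε ⟨l + 1, h⟩ = 1 ∧ g ⟨l + 1, by omega⟩ ∈ A) ∨
        (ε ⟨l, by omega⟩ = 1 ∧ ε ⟨l + 1, h⟩ = -1 ∧ g ⟨l + 1, by omega⟩ ∈ B))) :
    (HNNExtension.of (g 0) : HNNExtension G B A φ.symm)
        * (List.ofFn (fun l : Fin n =>
            HNNExtension.t ^ ε l * HNNExtension.of (g l.succ))).prod ≠ 1 ∧
      -- in particular, the natural homomorphism `G → 𝒢` is injective
      Function.Injective (fun x : G => (HNNExtension.of x : HNNExtension G B A φ.symm)) := by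
  refine ⟨?_, HNNExtension.of_injective φ.symm⟩
  intro hprod
  have hex : ∀ l, ∃ u : ℤˣ, (u : ℤ) = ε l := by
    intro l
    rcases hε l with h | h
    · exact ⟨1, by simp [h]⟩
    · exact ⟨-1, by simp [h]⟩
  choose u hu using hex
  let w : HNNExtension.NormalWord.ReducedWord G B A :=
    { head := g 0
      toList := List.ofFn (fun l : Fin n => (u l, g l.succ))
      chain := by
        rw [List.isChain_iff_getElem]
        intro i hi
        simp only [List.length_ofFn] at hi
        simp only [List.getElem_ofFn]
        intro hmem
        have hp := hpinch i hi
        rw [← hu, ← hu] at hp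
        rcases Int.units_eq_one_or (u ⟨i, by omega⟩) with h1 | h1 <;>
        rcases Int.units_eq_one_or (u ⟨i + 1, hi⟩) with h2 | h2
        · rw [h1, h2]
        · exfalso
          rw [h1] at hmem
          exact hp (Or.inr ⟨by rw [h1]; rfl, by rw [h2]; rfl, hmem⟩)
        · exfalso
          rw [h1] at hmem
          exact hp (Or.inl ⟨by rw [h1]; rfl, by rw [h2]; rfl, hmem⟩)
        · rw [h1, h2] }
  have hw : w.prod φ.symm = 1 := by
    rw [← hprod]
    simp only [HNNExtension.NormalWord.ReducedWord.prod, w, List.map_ofFn]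
    congr 3
    funext l
    simp [hu]
  have hnil := HNNExtension.ReducedWord.toList_eq_nil_of_mem_of_range φ.symm w
    (by rw [hw]; exact one_mem _)
  have hlen := congrArg List.length hnil
  simp only [w, List.length_ofFn, List.length_nil] at hlen
  omega
end
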